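/- (Mercer's theorem) Let a < b be real numbers and let k : [a,b] × [a,b] → ℝ be a continuous, symmetric kernel (k(x,y) = k(y,x)) that is positive semi-definite, in the sense that for every n, every choice of points x_1, ..., x_n ∈ [a,b], and every c ∈ ℝⁿ, one has Σ_{i,j=1}^n c_i c_j k(x_i, x_j) ≥ 0. Then there exist a sequence of nonnegative reals (λ_i)_{i∈ℕ} and continuous functions u_i : [a,b] → ℝ satisfying ∫_a^b u_i(x) u_j(x) dx = δ_{ij}, such that for every i and every x ∈ [a,b], ∫_a^b k(x, y) u_i(y) dy = λ_i u_i(x), and the series Σ_{i=1}^∞ λ_i u_i(x) u_i(y) converges absolutely and uniformly on [a,b] × [a,b] to k(x, y). -/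

import Mathlib

open MeasureTheory Filter

namespace Mercer

open Topology InnerProductSpace

lemma sum_nonneg_of_fintype {X ι : Type*} [Fintype ι] {K : X → X → ℝ}
    (hK : ∀ (n : ℕ) (x : Fin n → X) (c : Fin n → ℝ), 0 ≤ ∑ i, ∑ j, c i * c j * K (x i) (x j))
    (x : ι → X) (c : ι → ℝ) : 0 ≤ ∑ i, ∑ j, c i * c j * K (x i) (x j) := by
  let e := (Fintype.equivFin ι).symm
  refine (hK _ (x ∘ e) (c ∘ e)).trans_eq ?_
  refine Fintype.sum_equiv e _ _ fun i => Fintype.sum_equiv e _ _ fun j => rfl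

lemma integral_comp_simpleFunc {X Y : Type*} [MeasurableSpace X] [MeasurableSpace Y]
    (μ : Measure X) [IsFiniteMeasure μ] (s : SimpleFunc X Y) (F : Y → ℝ) :
    ∫ x, F (s x) ∂μ = ∑ p : s.range, μ.real (s ⁻¹' {p.1}) * F p := by
  have h (x : X) : F (s x) =
      ∑ p : s.range, (s ⁻¹' {p.1}).indicator (fun _ => F p) x := by
    rw [Finset.sum_eq_single ⟨s x, s.mem_range_self x⟩]
    · simp
    · rintro ⟨p, hp⟩ - hne
      refine Set.indicator_of_notMem (fun hx => hne ?_) _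
      exact Subtype.ext (Set.mem_singleton_iff.1 hx).symm
    · simp
  simp_rw [h]
  rw [integral_finsetSum _ fun p _ => (integrable_const _).indicator (s.measurableSet_preimage _)]
  simp [integral_indicator_const _ (s.measurableSet_preimage _)]

section Abstract

variable {H : Type*} [NormedAddCommGroup H] [InnerProductSpace ℝ H]

lemma apply_eq_zero_of_mem_orthogonal [CompleteSpace H] {T : H →L[ℝ] H} (hT : IsCompactOperator T)
    (hT' : T.IsSymmetric) {s : Set H} (hs : ∀ v ∈ s, ∃ l : ℝ, T v = l • v)
    (hmax : ∀ (v : H) (l : ℝ), l ≠ 0 → T v = l • v → (∀ e ∈ s, ⟪e, v⟫_ℝ = 0) → v = 0)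
    {v : H} (hv : ∀ e ∈ s, ⟪e, v⟫_ℝ = 0) : T v = 0 := by
  set V : Submodule ℝ H := (Submodule.span ℝ s)ᗮ
  have hmem (w : H) : w ∈ V ↔ ∀ e ∈ s, ⟪e, w⟫_ℝ = 0 := by
    rw [Submodule.mem_orthogonal]
    refine ⟨fun h e he => h e (Submodule.subset_span he), fun h u hu => ?_⟩
    induction hu using Submodule.span_induction with
    | mem x hx => exact h x hx
    | zero => simp
    | add x y _ _ hx hy => simp [inner_add_left, hx, hy]
    | smul a x _ hx => simp [inner_smul_left, hx]
  have hinv : ∀ w ∈ V, T w ∈ V := by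
    intro w hw
    rw [hmem] at hw ⊢
    intro e he
    obtain ⟨l, hl⟩ := hs e he
    have := hT' e w
    simp only [ContinuousLinearMap.coe_coe] at this
    rw [← this, hl, inner_smul_left, hw e he, mul_zero]
  let S : V →L[ℝ] V := T.restrict hinv
  have hS_compact : IsCompactOperator S := hT.restrict' hinv
  have hS_symm : S.IsSymmetric := hT'.restrict_invariant hinv
  have hS : S = 0 := by
    rw [← ContinuousLinearMap.eq_zero_of_forall_hasEigenvalue_eq_zero hS_compact hS_symm]
    intro l hl
    by_contra hl0
    obtain ⟨w, hw⟩ := hl.exists_hasEigenvector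
    refine hw.2 (Subtype.ext (hmax w l hl0 (congrArg Subtype.val hw.apply_eq_smul) ?_))
    exact (hmem _).1 w.2
  exact congrArg Subtype.val (DFunLike.congr_fun hS ⟨v, (hmem v).2 hv⟩)

lemma countable_of_orthonormal [TopologicalSpace.SeparableSpace H] {s : Set H}
    (hs : Orthonormal ℝ (Subtype.val : s → H)) : s.Countable := by
  refine Set.PairwiseDisjoint.countable_of_isOpen (s := fun v => Metric.ball v (1 / 2)) ?_
    (fun _ _ => Metric.isOpen_ball) (fun v _ => ⟨v, by simp⟩)
  intro v hv w hw hvw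
  refine Metric.ball_disjoint_ball ?_
  have h0 : ⟪v, w⟫_ℝ = 0 := hs.2 (i := ⟨v, hv⟩) (j := ⟨w, hw⟩) (by simpa using hvw)
  have h1 : ‖v‖ = 1 := hs.1 ⟨v, hv⟩
  have h2 : ‖w‖ = 1 := hs.1 ⟨w, hw⟩
  have h3 := norm_sub_sq_real v w
  rw [dist_eq_norm]
  rw [h0, h1, h2] at h3
  nlinarith [norm_nonneg (v - w)]

/-- A maximal orthonormal subset of a given set of vectors. -/
lemma exists_maximal_orthonormal_subset (S : Set H) :
    ∃ s ⊆ S, Orthonormal ℝ (Subtype.val : s → H) ∧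
      ∀ v ∈ S, ‖v‖ = 1 → ¬ ∀ e ∈ s, ⟪e, v⟫_ℝ = 0 := by
  obtain ⟨s, hs⟩ := zorn_subset {s : Set H | s ⊆ S ∧ Orthonormal ℝ (Subtype.val : s → H)} (by
    intro c hc hchain
    refine ⟨⋃₀ c, ⟨Set.sUnion_subset fun t ht => (hc ht).1, ?_⟩, fun t => Set.subset_sUnion_of_mem⟩
    exact orthonormal_sUnion_of_directed hchain.directedOn fun t ht => (hc ht).2)
  refine ⟨s, hs.prop.1, hs.prop.2, fun v hvS hv1 hv => ?_⟩
  have hins : Orthonormal ℝ (Subtype.val : ↥(insert v s) → H) := by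
    classical
    rw [orthonormal_subtype_iff_ite]
    have hso := orthonormal_subtype_iff_ite.1 hs.prop.2
    rintro x (rfl | hx) y (rfl | hy)
    · simp [hv1]
    · rw [real_inner_comm, hv y hy, if_neg]
      rintro rfl
      simpa [hv1, real_inner_self_eq_norm_sq] using hv _ hy
    · rw [hv x hx, if_neg]
      rintro rfl
      simpa [hv1, real_inner_self_eq_norm_sq] using hv _ hx
    · exact hso x hx y hy
  have := hs.le_of_ge (y := insert v s) ⟨Set.insert_subset hvS hs.prop.1, hins⟩
    (Set.subset_insert v s) (Set.mem_insert v s)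
  have h := hv v this
  rw [real_inner_self_eq_norm_sq, hv1] at h
  norm_num at h

end Abstract

section InnerOp

variable {X H : Type*} [TopologicalSpace X] [CompactSpace X] [NormedAddCommGroup H]
  [InnerProductSpace ℝ H]

/-- The operator sending `f` to the continuous function `x ↦ ⟪Φ x, f⟫`. -/
noncomputable def innerOp (Φ : C(X, H)) : H →L[ℝ] C(X, ℝ) :=
  LinearMap.mkContinuous
    { toFun := fun f => ⟨fun x => ⟪Φ x, f⟫_ℝ, by fun_prop⟩
      map_add' := fun f g => by ext; simp [inner_add_right]
      map_smul' := fun c f => by ext; simp [inner_smul_right] } ‖Φ‖ fun f => by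
    rw [ContinuousMap.norm_le _ (by positivity)]
    intro x
    exact (norm_inner_le_norm _ _).trans (by gcongr; exact Φ.norm_coe_le_norm x)

@[simp]
lemma innerOp_apply (Φ : C(X, H)) (f : H) (x : X) : innerOp Φ f x = ⟪Φ x, f⟫_ℝ := rfl

lemma isCompactOperator_innerOp (Φ : C(X, H)) : IsCompactOperator (innerOp Φ) := by
  let e := ContinuousMap.linearIsometryBoundedOfCompact X ℝ ℝ
  have h : IsCompact (closure (e ∘ innerOp Φ '' Metric.closedBall 0 1)) := by
    refine BoundedContinuousFunction.arzela_ascoli (Metric.closedBall (0 : ℝ) ‖Φ‖)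
      (isCompact_closedBall _ _) _ ?_ ?_
    · rintro _ x ⟨f, hf, rfl⟩
      have : ‖f‖ ≤ 1 := by simpa using hf
      rw [mem_closedBall_zero_iff]
      calc ‖⟪Φ x, f⟫_ℝ‖ ≤ ‖Φ x‖ * ‖f‖ := norm_inner_le_norm _ _
        _ ≤ ‖Φ‖ * 1 := by gcongr; exact Φ.norm_coe_le_norm x
        _ = ‖Φ‖ := mul_one _
    · intro x₀
      rw [Metric.equicontinuousAt_iff_right]
      intro ε hε
      have := Metric.tendsto_nhds.1 (Φ.continuous.tendsto x₀) ε hε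
      filter_upwards [this] with x hx
      rintro ⟨_, f, hf, rfl⟩
      have hf1 : ‖f‖ ≤ 1 := by simpa using hf
      change dist ⟪Φ x₀, f⟫_ℝ ⟪Φ x, f⟫_ℝ < ε
      rw [dist_eq_norm] at hx
      rw [dist_comm, dist_eq_norm, ← inner_sub_left]
      calc ‖⟪Φ x - Φ x₀, f⟫_ℝ‖ ≤ ‖Φ x - Φ x₀‖ * ‖f‖ := norm_inner_le_norm _ _
        _ ≤ ‖Φ x - Φ x₀‖ * 1 := by gcongr
        _ < ε := by simpa using hx
  have h' : IsCompactOperator (e ∘ innerOp Φ) := by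
    have := (isCompactOperator_iff_isCompact_closure_image_closedBall
      (e.toLinearEquiv.toLinearMap ∘ₗ (innerOp Φ).toLinearMap) one_pos).2 h
    exact this
  have := h'.continuous_comp e.symm.continuous
  simpa [Function.comp_def] using this

end InnerOp

section Kernel

variable {X : Type*} [MetricSpace X] [CompactSpace X] [MeasurableSpace X] [BorelSpace X]
  (μ : Measure X) [IsFiniteMeasure μ]

/-- Positivity of a positive semi-definite kernel, tested against the measure `c δ_x + g μ`. -/
lemma quadratic_form_nonneg {K : C(X × X, ℝ)}
    (hK : ∀ (n : ℕ) (x : Fin n → X) (c : Fin n → ℝ), 0 ≤ ∑ i, ∑ j, c i * c j * K (x i, x j))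
    (hsymm : ∀ x y, K (x, y) = K (y, x)) (x : X) (c : ℝ) (g : C(X, ℝ)) :
    0 ≤ c ^ 2 * K (x, x) + 2 * c * ∫ y, K (x, y) * g y ∂μ +
      ∫ z, (∫ y, K (z, y) * g y ∂μ) * g z ∂μ := by
  let s (n : ℕ) : SimpleFunc X X := SimpleFunc.approxOn id measurable_id Set.univ x trivial n
  have hs (y : X) : Tendsto (fun n => s n y) atTop (𝓝 y) :=
    SimpleFunc.tendsto_approxOn measurable_id (Set.mem_univ x) (by simp)
  have hpos (n : ℕ) : 0 ≤ c ^ 2 * K (x, x) + 2 * c * ∫ y, K (x, s n y) * g (s n y) ∂μ +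
      ∫ z, (∫ y, K (s n z, s n y) * g (s n y) ∂μ) * g (s n z) ∂μ := by
    rw [integral_comp_simpleFunc μ (s n) (fun p => K (x, p) * g p),
      integral_comp_simpleFunc μ (s n) (fun q => (∫ y, K (q, s n y) * g (s n y) ∂μ) * g q)]
    have h := fun q => integral_comp_simpleFunc μ (s n) (fun p => K (q, p) * g p)
    simp_rw [h]
    let pt : Option (s n).range → X := fun o => o.elim x Subtype.val
    let wt : Option (s n).range → ℝ :=
      fun o => o.elim c fun p => μ.real (s n ⁻¹' {p.1}) * g p
    refine (sum_nonneg_of_fintype (K := fun x y => K (x, y)) hK pt wt).trans_eq ?_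
    simp only [Fintype.sum_option, pt, wt, Option.elim_none, Option.elim_some,
      Finset.sum_add_distrib, Finset.mul_sum, Finset.sum_mul, hsymm _ x]
    have e1 (p : (s n).range) : μ.real (s n ⁻¹' {p.1}) * g p * c * K (x, p) =
      c * (μ.real (s n ⁻¹' {p.1}) * g p) * K (x, p) := by ring
    have e2 (p : (s n).range) : 2 * c * (μ.real (s n ⁻¹' {p.1}) * (K (x, p) * g p)) =
      c * (μ.real (s n ⁻¹' {p.1}) * g p) * K (x, p) +
      c * (μ.real (s n ⁻¹' {p.1}) * g p) * K (x, p) := by ring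
    simp_rw [e1, e2, Finset.sum_add_distrib]
    have e3 (p q : (s n).range) : μ.real (s n ⁻¹' {p.1}) *
        (μ.real (s n ⁻¹' {q.1}) * (K (p, q) * g q) * g p) =
      μ.real (s n ⁻¹' {p.1}) * g p * (μ.real (s n ⁻¹' {q.1}) * g q) * K (p, q) := by ring
    simp_rw [e3]
    ring
  have hbound (z y : X) : ‖K (z, y) * g y‖ ≤ ‖K‖ * ‖g‖ := by
    rw [norm_mul]
    gcongr
    exacts [K.norm_coe_le_norm _, g.norm_coe_le_norm _]
  have hlim (z : X) (f : ℕ → X) (hf : Tendsto f atTop (𝓝 z)) :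
      Tendsto (fun n => ∫ y, K (f n, s n y) * g (s n y) ∂μ) atTop
        (𝓝 (∫ y, K (z, y) * g y ∂μ)) := by
    refine tendsto_integral_of_dominated_convergence (fun _ => ‖K‖ * ‖g‖) (fun n => ?_)
      (integrable_const _) (fun n => ae_of_all _ fun y => hbound _ _) (ae_of_all _ fun y => ?_)
    · exact ((s n).map fun p => K (f n, p) * g p).aestronglyMeasurable
    · exact ((K.continuous.tendsto (z, y)).comp (hf.prodMk_nhds (hs y))).mul
        ((g.continuous.tendsto y).comp (hs y))
  have hlim2 : Tendsto (fun n => ∫ z, (∫ y, K (s n z, s n y) * g (s n y) ∂μ) * g (s n z) ∂μ) atTop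
      (𝓝 (∫ z, (∫ y, K (z, y) * g y ∂μ) * g z ∂μ)) := by
    refine tendsto_integral_of_dominated_convergence
      (fun _ => ‖K‖ * ‖g‖ * μ.real Set.univ * ‖g‖) (fun n => ?_)
      (integrable_const _) (fun n => ae_of_all _ fun z => ?_) (ae_of_all _ fun z => ?_)
    · exact ((s n).map fun p => (∫ y, K (p, s n y) * g (s n y) ∂μ) * g p).aestronglyMeasurable
    · rw [norm_mul]
      gcongr
      · exact norm_integral_le_of_norm_le_const (ae_of_all _ fun y => hbound _ _)
      · exact g.norm_coe_le_norm _
    · exact (hlim z _ (hs z)).mul ((g.continuous.tendsto z).comp (hs z))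
  exact ge_of_tendsto' (((hlim x (fun _ => x) tendsto_const_nhds).const_mul (2 * c)).const_add _
    |>.add hlim2) hpos

/-- The sections of a kernel as elements of `L²`. -/
noncomputable def kernelSection (K : C(X × X, ℝ)) : C(X, Lp ℝ 2 μ) :=
  ⟨fun x => ContinuousMap.toLp 2 μ ℝ (K.curry x), by fun_prop⟩

/-- The integral operator `f ↦ ∫ K(·, y) f(y) dy` from `L²` to continuous functions. -/
noncomputable def integralOp (K : C(X × X, ℝ)) : Lp ℝ 2 μ →L[ℝ] C(X, ℝ) :=
  innerOp (kernelSection μ K)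

/-- The integral operator as an endomorphism of `L²`. -/
noncomputable def integralOp₂ (K : C(X × X, ℝ)) : Lp ℝ 2 μ →L[ℝ] Lp ℝ 2 μ :=
  ContinuousMap.toLp 2 μ ℝ ∘L integralOp μ K

lemma isCompactOperator_integralOp₂ (K : C(X × X, ℝ)) : IsCompactOperator (integralOp₂ μ K) :=
  (isCompactOperator_innerOp _).clm_comp (ContinuousMap.toLp 2 μ ℝ)

lemma inner_toLp_left (f : C(X, ℝ)) (g : Lp ℝ 2 μ) :
    ⟪ContinuousMap.toLp 2 μ ℝ f, g⟫_ℝ = ∫ y, f y * g y ∂μ := by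
  rw [L2.inner_def]
  refine integral_congr_ae ?_
  filter_upwards [ContinuousMap.coeFn_toLp (p := 2) (𝕜 := ℝ) μ f] with y hy
  rw [hy, real_inner_eq_re_inner, RCLike.inner_apply]; simp [mul_comm]

lemma inner_toLp_toLp (f g : C(X, ℝ)) :
    ⟪ContinuousMap.toLp 2 μ ℝ f, ContinuousMap.toLp 2 μ ℝ g⟫_ℝ = ∫ y, f y * g y ∂μ := by
  rw [ContinuousMap.inner_toLp]
  simp [mul_comm]

lemma integralOp_apply (K : C(X × X, ℝ)) (f : Lp ℝ 2 μ) (x : X) :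
    integralOp μ K f x = ∫ y, K (x, y) * f y ∂μ :=
  inner_toLp_left μ (K.curry x) f

lemma integralOp_toLp (K : C(X × X, ℝ)) (f : C(X, ℝ)) (x : X) :
    integralOp μ K (ContinuousMap.toLp 2 μ ℝ f) x = ∫ y, K (x, y) * f y ∂μ :=
  inner_toLp_toLp μ (K.curry x) f

lemma isSymmetric_integralOp₂ {K : C(X × X, ℝ)} (hsymm : ∀ x y, K (x, y) = K (y, x)) :
    (integralOp₂ μ K).IsSymmetric := by
  intro f g
  have hf : Integrable f μ := (Lp.memLp f).integrable one_le_two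
  have hg : Integrable g μ := (Lp.memLp g).integrable one_le_two
  change ⟪ContinuousMap.toLp 2 μ ℝ (integralOp μ K f), g⟫_ℝ =
    ⟪f, ContinuousMap.toLp 2 μ ℝ (integralOp μ K g)⟫_ℝ
  rw [real_inner_comm _ f, inner_toLp_left, inner_toLp_left]
  simp_rw [integralOp_apply, ← integral_mul_const]
  rw [integral_integral_swap]
  · congr! 4 with x y
    rw [hsymm]
    ring
  · have h : Integrable (fun p : X × X => K p * (g p.1 * f p.2)) (μ.prod μ) :=
      (hg.mul_prod hf).bdd_mul (c := ‖K‖) K.continuous.aestronglyMeasurable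
        (ae_of_all _ K.norm_coe_le_norm)
    refine h.congr (ae_of_all _ fun p => ?_)
    simp only [Function.uncurry]
    ring

variable {K : C(X × X, ℝ)} {lam : ℕ → ℝ} {u : ℕ → C(X, ℝ)}

lemma eigenvalue_nonneg
    (hK : ∀ (n : ℕ) (x : Fin n → X) (c : Fin n → ℝ), 0 ≤ ∑ i, ∑ j, c i * c j * K (x i, x j))
    (hsymm : ∀ x y, K (x, y) = K (y, x))
    (horth : Orthonormal ℝ (fun i => ContinuousMap.toLp 2 μ ℝ (u i)))
    (heig : ∀ i, integralOp μ K (ContinuousMap.toLp 2 μ ℝ (u i)) = lam i • u i) (i : ℕ) :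
    0 ≤ lam i := by
  have hne : Nonempty X := by
    by_contra h
    rw [not_nonempty_iff] at h
    have h1 : ‖ContinuousMap.toLp 2 μ ℝ (u i)‖ = 1 := horth.1 i
    rw [Subsingleton.elim (u i) 0, map_zero, norm_zero] at h1
    norm_num at h1
  have h := quadratic_form_nonneg μ hK hsymm hne.some 0 (u i)
  simp_rw [← integralOp_toLp, heig] at h
  have h2 : ‖ContinuousMap.toLp 2 μ ℝ (u i)‖ = 1 := horth.1 i
  have h1 := inner_toLp_toLp μ (lam i • u i) (u i)
  rw [map_smul, inner_smul_left, real_inner_self_eq_norm_sq, h2] at h1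
  rw [← h1] at h
  simpa using h

lemma sum_eigenvalue_mul_sq_le
    (hK : ∀ (n : ℕ) (x : Fin n → X) (c : Fin n → ℝ), 0 ≤ ∑ i, ∑ j, c i * c j * K (x i, x j))
    (hsymm : ∀ x y, K (x, y) = K (y, x))
    (horth : Orthonormal ℝ (fun i => ContinuousMap.toLp 2 μ ℝ (u i)))
    (heig : ∀ i, integralOp μ K (ContinuousMap.toLp 2 μ ℝ (u i)) = lam i • u i)
    (F : Finset ℕ) (x : X) : ∑ i ∈ F, lam i * u i x ^ 2 ≤ K (x, x) := by
  let g : C(X, ℝ) := ∑ i ∈ F, (-u i x) • u i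
  have hg : integralOp μ K (ContinuousMap.toLp 2 μ ℝ g) = ∑ i ∈ F, (-u i x) • lam i • u i := by
    simp only [g, map_sum, map_smul, heig]
  have h := quadratic_form_nonneg μ hK hsymm x 1 g
  simp_rw [← integralOp_toLp] at h
  rw [← inner_toLp_toLp, hg] at h
  have h1 : ⟪ContinuousMap.toLp 2 μ ℝ (∑ i ∈ F, (-u i x) • lam i • u i),
      ContinuousMap.toLp 2 μ ℝ g⟫_ℝ = ∑ i ∈ F, lam i * u i x ^ 2 := by
    simp only [g, map_sum, map_smul, smul_smul]
    rw [horth.inner_sum]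
    refine Finset.sum_congr rfl fun i _ => ?_
    simp
    ring
  have h2 : (∑ i ∈ F, (-u i x) • lam i • u i) x = - ∑ i ∈ F, lam i * u i x ^ 2 := by
    simp only [ContinuousMap.sum_apply, ContinuousMap.smul_apply, smul_eq_mul,
      ← Finset.sum_neg_distrib]
    refine Finset.sum_congr rfl fun i _ => by ring
  rw [h1, h2] at h
  linarith

section OpenPos

variable [μ.IsOpenPosMeasure]

/-- The integral operator has an orthonormal sequence of continuous eigenfunctions whose orthogonal
complement lies in its kernel. -/
lemma exists_eigenfunctions (hsymm : ∀ x y, K (x, y) = K (y, x))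
    (hinf : ¬ FiniteDimensional ℝ C(X, ℝ)) :
    ∃ (lam : ℕ → ℝ) (u : ℕ → C(X, ℝ)),
      Orthonormal ℝ (fun i => ContinuousMap.toLp 2 μ ℝ (u i)) ∧
      (∀ i, integralOp μ K (ContinuousMap.toLp 2 μ ℝ (u i)) = lam i • u i) ∧
      ∀ v, (∀ i, ⟪ContinuousMap.toLp 2 μ ℝ (u i), v⟫_ℝ = 0) → integralOp μ K v = 0 := by
  set ι : C(X, ℝ) →L[ℝ] Lp ℝ 2 μ := ContinuousMap.toLp 2 μ ℝ
  have hι : Function.Injective ι := ContinuousMap.toLp_injective μ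
  obtain ⟨s, hsS, hso, hmax⟩ := exists_maximal_orthonormal_subset
    {v : Lp ℝ 2 μ | ∃ (f : C(X, ℝ)) (l : ℝ), ι f = v ∧ integralOp μ K v = l • f}
  have hsS' (v : Lp ℝ 2 μ) (hv : v ∈ s) :
      ∃ (f : C(X, ℝ)) (l : ℝ), ι f = v ∧ integralOp μ K v = l • f := hsS hv
  choose! u lam hu hlam using hsS'
  have hmax' (f : C(X, ℝ)) (l : ℝ) (hf : integralOp μ K (ι f) = l • f)
      (horth : ∀ e ∈ s, ⟪e, ι f⟫_ℝ = 0) : f = 0 := by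
    by_contra hf0
    have hn : ‖ι f‖ ≠ 0 := by simpa using (map_ne_zero_iff ι hι).2 hf0
    refine hmax (ι (‖ι f‖⁻¹ • f)) ⟨_, l, rfl, ?_⟩ ?_ ?_
    · rw [map_smul, map_smul, hf, smul_comm]
    · rw [map_smul, norm_smul, norm_inv, norm_norm, inv_mul_cancel₀ hn]
    · intro e he
      rw [map_smul, inner_smul_right, horth e he, mul_zero]
  have hker (v : Lp ℝ 2 μ) (hv : ∀ e ∈ s, ⟪e, v⟫_ℝ = 0) : integralOp μ K v = 0 := by
    refine hι ((apply_eq_zero_of_mem_orthogonal (isCompactOperator_integralOp₂ μ K)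
      (isSymmetric_integralOp₂ μ hsymm) (fun e he => ⟨lam e, ?_⟩) ?_ hv).trans (map_zero ι).symm)
    · change ι (integralOp μ K e) = _
      rw [hlam e he, map_smul, hu e he]
    · intro w l hl hw horth
      have hw' : ι (l⁻¹ • integralOp μ K w) = w := by
        rw [map_smul]
        change l⁻¹ • integralOp₂ μ K w = w
        rw [hw, inv_smul_smul₀ hl]
      rw [← hw', hmax' (l⁻¹ • integralOp μ K w) l (by rw [hw', smul_inv_smul₀ hl])
        (by rwa [hw']), map_zero]
  have hcount : s.Countable := by
    have : TopologicalSpace.SeparableSpace (Lp ℝ 2 μ) :=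
      (ContinuousMap.toLp_denseRange ℝ μ ℝ (by simp)).separableSpace ι.continuous
    exact countable_of_orthonormal hso
  have hsinf : s.Infinite := by
    intro hfin
    refine hinf ?_
    have hspan (f : C(X, ℝ)) : f ∈ Submodule.span ℝ (u '' s) := by
      let g : C(X, ℝ) := f - ∑ e ∈ hfin.toFinset, ⟪e, ι f⟫_ℝ • u e
      have hg : ∀ e ∈ s, ⟪e, ι g⟫_ℝ = 0 := by
        intro e he
        simp only [g, map_sub, map_sum, map_smul, inner_sub_right, inner_sum, inner_smul_right]
        rw [Finset.sum_eq_single_of_mem e (hfin.mem_toFinset.2 he)]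
        · rw [hu e he, real_inner_self_eq_norm_sq, hso.1 ⟨e, he⟩]
          ring
        · intro e' he' hne
          have he' := hfin.mem_toFinset.1 he'
          have h0 : ⟪e, e'⟫_ℝ = 0 :=
            hso.2 (i := ⟨e, he⟩) (j := ⟨e', he'⟩) (by simpa using hne.symm)
          rw [hu e' he', h0, mul_zero]
      have hg0 := hmax' g 0 (by rw [hker _ hg, zero_smul]) hg
      rw [sub_eq_zero.1 hg0]
      refine Submodule.sum_mem _ fun e he => Submodule.smul_mem _ _ (Submodule.subset_span ?_)
      exact Set.mem_image_of_mem _ (hfin.mem_toFinset.1 he)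
    have : Submodule.span ℝ (u '' s) = ⊤ := eq_top_iff.2 fun f _ => hspan f
    exact ⟨this ▸ Submodule.fg_span (hfin.image u)⟩
  have := hsinf.to_subtype
  have := hcount.to_subtype
  obtain ⟨e⟩ : Nonempty (ℕ ≃ s) := nonempty_equiv_of_countable
  refine ⟨fun i => lam (e i), fun i => u (e i), ?_, fun i => ?_, fun v hv => ?_⟩
  · simp_rw [hu _ (e _).2]
    exact hso.comp e e.injective
  · rw [hu _ (e i).2, hlam _ (e i).2]
  · refine hker v fun w hw => ?_
    simpa [hu w hw] using hv (e.symm ⟨w, hw⟩)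

lemma hasSum_kernel
    (hK : ∀ (n : ℕ) (x : Fin n → X) (c : Fin n → ℝ), 0 ≤ ∑ i, ∑ j, c i * c j * K (x i, x j))
    (hsymm : ∀ x y, K (x, y) = K (y, x))
    (horth : Orthonormal ℝ (fun i => ContinuousMap.toLp 2 μ ℝ (u i)))
    (heig : ∀ i, integralOp μ K (ContinuousMap.toLp 2 μ ℝ (u i)) = lam i • u i)
    (hker : ∀ v, (∀ i, ⟪ContinuousMap.toLp 2 μ ℝ (u i), v⟫_ℝ = 0) → integralOp μ K v = 0)
    (x y : X) : HasSum (fun i => lam i * (u i x * u i y)) (K (x, y)) := by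
  have hlam := eigenvalue_nonneg μ hK hsymm horth heig
  have hle := sum_eigenvalue_mul_sq_le μ hK hsymm horth heig
  have hsum : Summable fun i => (lam i * u i x) • u i := by
    rw [summable_iff_vanishing_norm]
    intro ε hε
    have hx : Summable fun i => lam i * u i x ^ 2 :=
      summable_of_sum_le (fun i => mul_nonneg (hlam i) (sq_nonneg _)) (hle · x)
    obtain ⟨s, hs⟩ := summable_iff_vanishing_norm.1 hx (ε ^ 2 / (‖K‖ + 1)) (by positivity)
    refine ⟨s, fun t ht => ?_⟩
    rw [ContinuousMap.norm_lt_iff _ hε]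
    intro z
    have h1 := Finset.sum_mul_sq_le_sq_mul_sq t (fun i => √(lam i) * u i x)
      (fun i => √(lam i) * u i z)
    have e1 (i : ℕ) : √(lam i) * u i x * (√(lam i) * u i z) = lam i * u i x * u i z := by
      linear_combination (u i x * u i z) * Real.mul_self_sqrt (hlam i)
    simp_rw [e1, mul_pow, Real.sq_sqrt (hlam _)] at h1
    have h2 := (le_abs_self _).trans_lt (hs t ht)
    have h3 : ∑ i ∈ t, lam i * u i z ^ 2 ≤ ‖K‖ :=
      (hle t z).trans ((le_abs_self _).trans (K.norm_coe_le_norm _))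
    have h4 : 0 ≤ ∑ i ∈ t, lam i * u i x ^ 2 :=
      Finset.sum_nonneg fun i _ => mul_nonneg (hlam i) (sq_nonneg _)
    simp only [ContinuousMap.sum_apply, ContinuousMap.smul_apply, smul_eq_mul, Real.norm_eq_abs]
    refine abs_lt_of_sq_lt_sq (h1.trans_lt ?_) hε.le
    rw [lt_div_iff₀ (by positivity)] at h2
    calc _ ≤ (∑ i ∈ t, lam i * u i x ^ 2) * (‖K‖ + 1) := by gcongr; linarith
      _ < ε ^ 2 := h2
  obtain ⟨L, hL⟩ := hsum
  have hL₂ := hL.mapL (ContinuousMap.toLp 2 μ ℝ)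
  simp only [map_smul] at hL₂
  set v : Lp ℝ 2 μ := ContinuousMap.toLp 2 μ ℝ L - kernelSection μ K x with hv
  have hvi (i : ℕ) : ⟪ContinuousMap.toLp 2 μ ℝ (u i), v⟫_ℝ = 0 := by
    have h1 := hL₂.mapL (innerSL ℝ (ContinuousMap.toLp 2 μ ℝ (u i)))
    have h2 : ⟪ContinuousMap.toLp 2 μ ℝ (u i), kernelSection μ K x⟫_ℝ = lam i * u i x := by
      rw [real_inner_comm]
      exact DFunLike.congr_fun (heig i) x
    have h3 := h1.unique (hasSum_single i fun j hj => by
      simp [horth.2 hj.symm])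
    rw [hv, inner_sub_right, h2]
    have h4 : ⟪ContinuousMap.toLp 2 μ ℝ (u i), ContinuousMap.toLp 2 μ ℝ (u i)⟫_ℝ = 1 := by
      rw [real_inner_self_eq_norm_sq, horth.1 i, one_pow]
    simp only [innerSL_apply_apply, inner_smul_right, h4] at h3
    rw [h3]
    ring
  have hv1 : ⟪kernelSection μ K x, v⟫_ℝ = 0 := DFunLike.congr_fun (hker v hvi) x
  have hv2 : ⟪v, ContinuousMap.toLp 2 μ ℝ L⟫_ℝ = 0 := by
    have h1 := hL₂.mapL (innerSL ℝ v)
    refine h1.unique ?_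
    convert! hasSum_zero with i
    simp [real_inner_comm, hvi]
  have hv0 : v = 0 := by
    rw [← inner_self_eq_zero (𝕜 := ℝ)]
    nth_rw 2 [hv]
    rw [inner_sub_right, hv2, real_inner_comm, hv1, sub_zero]
  have hLK : L = K.curry x := ContinuousMap.toLp_injective μ (sub_eq_zero.1 hv0)
  have := hL.mapL (ContinuousMap.evalCLM ℝ y)
  simpa [hLK, mul_assoc] using this

end OpenPos

end Kernel

lemma tendstoUniformly_of_hasSum_kernel {X : Type*} [TopologicalSpace X] [CompactSpace X]
    {K : C(X × X, ℝ)} {lam : ℕ → ℝ} {u : ℕ → C(X, ℝ)} (hlam : ∀ i, 0 ≤ lam i)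
    (hsum : ∀ x y, HasSum (fun i => lam i * (u i x * u i y)) (K (x, y))) :
    TendstoUniformly (fun (n : ℕ) (p : X × X) => ∑ i ∈ Finset.range n, lam i * (u i p.1 * u i p.2))
      K atTop := by
  have hdiag : TendstoUniformly
      (fun (n : ℕ) (x : X) => ∑ i ∈ Finset.range n, lam i * (u i x * u i x))
      (fun x => K (x, x)) atTop := by
    refine Monotone.tendstoUniformly_of_forall_tendsto (fun n => by fun_prop) ?_ (by fun_prop)
      fun x => (hsum x x).tendsto_sum_nat
    intro m n hmn x
    exact Finset.sum_le_sum_of_subset_of_nonneg (Finset.range_mono hmn)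
      fun i _ _ => mul_nonneg (hlam i) (mul_self_nonneg _)
  rw [Metric.tendstoUniformly_iff] at hdiag ⊢
  intro ε hε
  filter_upwards [hdiag ε hε] with n hn p
  have htail (x y : X) := (hasSum_nat_add_iff' n).2 (hsum x y)
  have hx := hn p.1
  have hy := hn p.2
  rw [Real.dist_eq] at hx hy ⊢
  have hx' := (le_abs_self _).trans_lt hx
  have hy' := (le_abs_self _).trans_lt hy
  have hadd := (htail p.1 p.1).add (htail p.2 p.2)
  have h1 := hasSum_le (fun i => ?_) ((htail p.1 p.2).mul_left 2) hadd
  have h2 := hasSum_le (fun i => ?_) ((htail p.1 p.2).mul_left (-2)) hadd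
  · rw [abs_lt]
    constructor <;> linarith
  all_goals nlinarith [mul_nonneg (hlam (i + n)) (sq_nonneg (u (i + n) p.1 - u (i + n) p.2)),
    mul_nonneg (hlam (i + n)) (sq_nonneg (u (i + n) p.1 + u (i + n) p.2))]

lemma not_finiteDimensional_continuousMap_Icc {a b : ℝ} (hab : a < b) :
    ¬ FiniteDimensional ℝ C(Set.Icc a b, ℝ) := by
  intro h
  refine Polynomial.not_finite (R := ℝ)
    (Module.Finite.of_injective (Polynomial.toContinuousMapOnAlgHom (Set.Icc a b)).toLinearMap ?_)
  rw [injective_iff_map_eq_zero]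
  intro p hp
  refine p.eq_zero_of_infinite_isRoot ((Set.Icc_infinite hab).mono fun x hx => ?_)
  exact DFunLike.congr_fun hp (⟨x, hx⟩ : Set.Icc a b)

lemma isFiniteMeasure_Icc (a b : ℝ) :
    IsFiniteMeasure (volume.comap ((↑) : Set.Icc a b → ℝ)) := by
  refine ⟨?_⟩
  rw [comap_subtype_coe_apply measurableSet_Icc, Set.image_univ, Subtype.range_coe]
  exact measure_Icc_lt_top

lemma isOpenPosMeasure_Icc {a b : ℝ} (hab : a < b) :
    (volume.comap ((↑) : Set.Icc a b → ℝ)).IsOpenPosMeasure := by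
  refine ⟨fun U hU ⟨x, hx⟩ => ?_⟩
  obtain ⟨V, hV, rfl⟩ := isOpen_induced_iff.1 hU
  have hx' : x.1 ∈ closure (Set.Ioo a b) := by
    rw [closure_Ioo hab.ne]
    exact x.2
  have hpos : 0 < volume (V ∩ Set.Ioo a b) :=
    (hV.inter isOpen_Ioo).measure_pos _ (mem_closure_iff.1 hx' V hV hx)
  rw [← Measure.map_apply measurable_subtype_coe hV.measurableSet,
    map_comap_subtype_coe measurableSet_Icc, Measure.restrict_apply hV.measurableSet]
  exact (hpos.trans_le (measure_mono (by gcongr; exact Set.Ioo_subset_Icc_self))).ne'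

end Mercer

/-- Mercer's theorem: a continuous, symmetric, positive semi-definite kernel
`k` on `[a,b] × [a,b]` admits nonnegative eigenvalues `λ i` with continuous, `L²`-orthonormal
eigenfunctions `u i`, and the series `∑ i, λ i * u i x * u i y` converges absolutely and
uniformly on `[a,b] × [a,b]` to `k x y`. -/
theorem stmt6
    (a b : ℝ) (hab : a < b)
    (k : ℝ → ℝ → ℝ)
    (hcont : ContinuousOn (fun p : ℝ × ℝ => k p.1 p.2) (Set.Icc a b ×ˢ Set.Icc a b))
    (hsymm : ∀ x ∈ Set.Icc a b, ∀ y ∈ Set.Icc a b, k x y = k y x)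
    (hpsd : ∀ (n : ℕ) (x : Fin n → ℝ), (∀ i, x i ∈ Set.Icc a b) →
      ∀ c : Fin n → ℝ, 0 ≤ ∑ i, ∑ j, c i * c j * k (x i) (x j)) :
    ∃ (lam : ℕ → ℝ) (u : ℕ → ℝ → ℝ),
      (∀ i, 0 ≤ lam i) ∧
      (∀ i, ContinuousOn (u i) (Set.Icc a b)) ∧
      (∀ i j : ℕ, (∫ x in Set.Icc a b, u i x * u j x) = if i = j then 1 else 0) ∧
      (∀ (i : ℕ), ∀ x ∈ Set.Icc a b,
        (∫ y in Set.Icc a b, k x y * u i y) = lam i * u i x) ∧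
      (∀ x ∈ Set.Icc a b, ∀ y ∈ Set.Icc a b,
        Summable fun i => lam i * |u i x * u i y|) ∧
      TendstoUniformlyOn
        (fun (n : ℕ) (p : ℝ × ℝ) => ∑ i ∈ Finset.range n, lam i * u i p.1 * u i p.2)
        (fun p : ℝ × ℝ => k p.1 p.2) atTop (Set.Icc a b ×ˢ Set.Icc a b) := by
  let K : C(Set.Icc a b × Set.Icc a b, ℝ) :=
    ⟨fun p => k p.1 p.2, hcont.comp_continuous (f := fun p : Set.Icc a b × Set.Icc a b =>
      ((p.1 : ℝ), (p.2 : ℝ))) (by fun_prop) fun p => ⟨p.1.2, p.2.2⟩⟩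
  have hKsymm (x y : Set.Icc a b) : K (x, y) = K (y, x) := hsymm x x.2 y y.2
  have hKpsd (n : ℕ) (x : Fin n → Set.Icc a b) (c : Fin n → ℝ) :
      0 ≤ ∑ i, ∑ j, c i * c j * K (x i, x j) :=
    hpsd n (fun i => x i) (fun i => (x i).2) c
  have := Mercer.isFiniteMeasure_Icc a b
  have := Mercer.isOpenPosMeasure_Icc hab
  obtain ⟨lam, u, horth, heig, hker⟩ := Mercer.exists_eigenfunctions
    (volume.comap ((↑) : Set.Icc a b → ℝ)) hKsymm
    (Mercer.not_finiteDimensional_continuousMap_Icc hab)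
  have hlam := Mercer.eigenvalue_nonneg _ hKpsd hKsymm horth heig
  have hsum := Mercer.hasSum_kernel _ hKpsd hKsymm horth heig hker
  have hext (i : ℕ) (x : Set.Icc a b) : Set.IccExtend hab.le (u i) x = u i x :=
    Set.IccExtend_val hab.le (u i) x
  refine ⟨lam, fun i => Set.IccExtend hab.le (u i), hlam,
    fun i => (u i).continuous.Icc_extend'.continuousOn, fun i j => ?_, fun i x hx => ?_,
    fun x hx y hy => ?_, ?_⟩
  · rw [← integral_subtype_comap measurableSet_Icc]
    simp_rw [hext]
    rw [← Mercer.inner_toLp_toLp]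
    exact orthonormal_iff_ite.1 horth i j
  · rw [← integral_subtype_comap measurableSet_Icc (fun y => k x y * Set.IccExtend hab.le (u i) y)]
    lift x to Set.Icc a b using hx
    simp_rw [hext]
    have h := DFunLike.congr_fun (heig i) x
    rwa [Mercer.integralOp_toLp] at h
  · lift x to Set.Icc a b using hx
    lift y to Set.Icc a b using hy
    refine (hsum x y).summable.abs.congr fun i => ?_
    simp only [hext, abs_mul (lam i), abs_of_nonneg (hlam i)]
  · have h := Mercer.tendstoUniformly_of_hasSum_kernel hlam hsum
    rw [Metric.tendstoUniformly_iff] at h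
    rw [Metric.tendstoUniformlyOn_iff]
    intro ε hε
    filter_upwards [h ε hε] with n hn p hp
    have := hn (⟨p.1, hp.1⟩, ⟨p.2, hp.2⟩)
    simpa [K, mul_assoc, Set.IccExtend_of_mem hab.le _ hp.1, Set.IccExtend_of_mem hab.le _ hp.2]
      using this
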